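/- arXiv:2112.00335 — 4 statements merged into one kernel-verified Lean document; each statement's English description precedes it below -/
import Mathlib

section
/- Let k be an algebraically closed field of characteristic zero, and let L be a 2-dimensional subspace of the space of symmetric 3×3 matrices over k such that every nonzero element of L has rank exactly 2. Then there exists a 2-dimensional subspace U ⊆ k³ such that the kernel of every nonzero element of L is contained in U; moreover, for any two linearly independent A, B ∈ L one has ker A ≠ ker B and U = ker A + ker B. (Equivalently, the image of a non-secant line on the secant cubic of the Veronese surface under the Gauss map [C] ↦ [ker C] is a projective line in P(k³).) -/
open Matrix

set_option maxHeartbeats 1000000 in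
theorem aux_rank_le_one {k : Type*} [Field k] (A : Matrix (Fin 3) (Fin 3) k)
    (h : A.adjugate = 0) : A.rank ≤ 1 := by
  by_cases hA : A = 0
  · subst hA; simp
  have hm : ∀ i j r l, A i j * A r l = A i l * A r j := by
    rw [Matrix.adjugate_fin_three] at h
    have h' := fun i j => congrFun (congrFun h i) j
    have h00 := h' 0 0
    have h01 := h' 0 1
    have h02 := h' 0 2
    have h10 := h' 1 0
    have h11 := h' 1 1
    have h12 := h' 1 2
    have h20 := h' 2 0
    have h21 := h' 2 1
    have h22 := h' 2 2
    simp at h00 h01 h02 h10 h11 h12 h20 h21 h22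
    intro i j r l
    fin_cases i <;> fin_cases j <;> fin_cases r <;> fin_cases l <;>
      dsimp only [Fin.reduceFinMk, Fin.zero_eta, Fin.mk_one, Fin.isValue] <;>
      first | ring1 | linear_combination h00 | linear_combination -h00 | linear_combination h01 | linear_combination -h01 | linear_combination h02 | linear_combination -h02 | linear_combination h10 | linear_combination -h10 | linear_combination h11 | linear_combination -h11 | linear_combination h12 | linear_combination -h12 | linear_combination h20 | linear_combination -h20 | linear_combination h21 | linear_combination -h21 | linear_combination h22 | linear_combination -h22
  have : ∃ i j, A i j ≠ 0 := by
    by_contra! hc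
    exact hA (by ext i j; simpa using hc i j)
  obtain ⟨i, j, hij⟩ := this
  have : A = vecMulVec (fun r => A r j) (fun l => A i l / A i j) := by
    ext r l
    simp only [vecMulVec_apply]
    field_simp
    linear_combination hm i j r l
  rw [this]
  exact Matrix.rank_vecMulVec_le _ _

theorem aux_det {k : Type*} [Field k] (A : Matrix (Fin 3) (Fin 3) k)
    (h : A.rank = 2) : A.det = 0 := by
  by_contra hd
  have := Matrix.rank_of_isUnit A ((Matrix.isUnit_iff_isUnit_det A).2 (isUnit_iff_ne_zero.2 hd))
  simp at this
  omega

theorem aux_ker {k : Type*} [Field k] (A : Matrix (Fin 3) (Fin 3) k)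
    (h : A.rank = 2) : Module.finrank k (LinearMap.ker A.mulVecLin) = 1 := by
  have := LinearMap.finrank_range_add_finrank_ker A.mulVecLin
  rw [Matrix.rank] at h
  simp at this
  omega

theorem aux_mul {k : Type*} [Field k] (A : Matrix (Fin 3) (Fin 3) k)
    (h : A.rank = 2) (u x : Fin 3 → k) (hu : u ≠ 0) (hAu : A *ᵥ u = 0) (hx : A *ᵥ x = 0) :
    ∃ c : k, x = c • u := by
  have h1 := aux_ker A h
  have := (finrank_eq_one_iff_of_nonzero' (⟨u, by simpa using hAu⟩ : LinearMap.ker A.mulVecLin)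
    (by simpa [Subtype.ext_iff] using hu)).1 h1 ⟨x, by simpa using hx⟩
  obtain ⟨c, hc⟩ := this
  exact ⟨c, by simpa using (congrArg Subtype.val hc).symm⟩

theorem aux_adj {k : Type*} [Field k] (A : Matrix (Fin 3) (Fin 3) k) (hs : A.IsSymm)
    (h : A.rank = 2) (u : Fin 3 → k) (hu : u ≠ 0) (hAu : A *ᵥ u = 0) :
    ∃ c : k, c ≠ 0 ∧ ∀ i j, A.adjugate i j = c * (u i * u j) := by
  have hne : A.adjugate ≠ 0 := fun h0 => by
    have := aux_rank_le_one A h0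
    omega
  have hm : A * A.adjugate = 0 := by rw [Matrix.mul_adjugate, aux_det A h, zero_smul]
  have hc : ∀ j, ∃ c : k, (fun i => A.adjugate i j) = c • u := fun j =>
    aux_mul A h u _ hu hAu (by
      ext i
      exact congrFun (congrFun hm i) j)
  choose f hf using hc
  have hf' : ∀ i j, A.adjugate i j = f j * u i := fun i j => congrFun (hf j) i
  have hsy : ∀ i j, A.adjugate i j = A.adjugate j i := fun i j => by
    have : A.adjugateᵀ = A.adjugate := by rw [Matrix.adjugate_transpose, hs.eq]
    exact (congrFun (congrFun this j) i)
  obtain ⟨i0, hi0⟩ : ∃ i, u i ≠ 0 := by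
    by_contra! hc
    exact hu (funext hc)
  have key : ∀ i j, A.adjugate i j = f i0 / u i0 * (u i * u j) := fun i j => by
    have := hsy i0 j
    rw [hf', hf'] at this
    rw [hf']
    field_simp
    linear_combination u i * this
  refine ⟨f i0 / u i0, fun h0 => hne ?_, key⟩
  ext i j
  rw [key, h0]; simp

theorem aux_iso {k : Type*} [Field k] [CharZero k] (A B : Matrix (Fin 3) (Fin 3) k)
    (hs : A.IsSymm) (h : A.rank = 2) (hd : ∀ t : k, (A + t • B).det = 0)
    (p q : Fin 3 → k) (hp : A *ᵥ p = 0) (hq : A *ᵥ q = 0) : p ⬝ᵥ B *ᵥ q = 0 := by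
  by_cases hu : p = 0
  · simp [hu]
  obtain ⟨b, rfl⟩ := aux_mul A h p q hu hp hq
  obtain ⟨c, hc, hadj⟩ := aux_adj A hs h p hu hp
  suffices hh : p ⬝ᵥ B *ᵥ p = 0 by simp [Matrix.mulVec_smul, hh]
  have e0 := hd 0
  have e1 := hd 1
  have e2 := hd (-1)
  have e3 := hd 2
  have h' := hadj
  rw [Matrix.adjugate_fin_three] at h'
  have h00 := h' 0 0
  have h01 := h' 0 1
  have h02 := h' 0 2
  have h10 := h' 1 0
  have h11 := h' 1 1
  have h12 := h' 1 2
  have h20 := h' 2 0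
  have h21 := h' 2 1
  have h22 := h' 2 2
  simp at h00 h01 h02 h10 h11 h12 h20 h21 h22
  simp [Matrix.det_fin_three] at e0 e1 e2 e3
  have h6 : (6 * c) * (p ⬝ᵥ B *ᵥ p) = 0 := by
    simp only [dotProduct, Matrix.mulVec, Fin.sum_univ_three]
    linear_combination -3 * e0 + 6 * e1 - 2 * e2 - e3 - 6 * (B 0 0 * h00 + B 1 0 * h01 + B 2 0 * h02
      + B 0 1 * h10 + B 1 1 * h11 + B 2 1 * h12 + B 0 2 * h20 + B 1 2 * h21 + B 2 2 * h22)
  simpa [hc] using h6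

theorem aux_adj_quad {k : Type*} [Field k] (A B : Matrix (Fin 3) (Fin 3) k) (i : Fin 3) :
    ∃ a b : k, ∀ t : k, (A + t • B).adjugate i i = B.adjugate i i * (t * t) + b * t + a := by
  simp only [Matrix.adjugate_fin_three]
  fin_cases i
  · refine ⟨A 1 1 * A 2 2 - A 1 2 * A 2 1, A 1 1 * B 2 2 + B 1 1 * A 2 2
      - A 1 2 * B 2 1 - B 1 2 * A 2 1, fun t => ?_⟩
    simp; ring
  · refine ⟨A 0 0 * A 2 2 - A 0 2 * A 2 0, A 0 0 * B 2 2 + B 0 0 * A 2 2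
      - A 0 2 * B 2 0 - B 0 2 * A 2 0, fun t => ?_⟩
    simp; ring
  · refine ⟨A 0 0 * A 1 1 - A 0 1 * A 1 0, A 0 0 * B 1 1 + B 0 0 * A 1 1
      - A 0 1 * B 1 0 - B 0 1 * A 1 0, fun t => ?_⟩
    simp; ring

theorem aux_distinct {k : Type*} [Field k] [IsAlgClosed k] [CharZero k]
    (A B : Matrix (Fin 3) (Fin 3) k) (hB : B.IsSymm) (hBr : B.rank = 2)
    (hs : ∀ t : k, (A + t • B).IsSymm) (hr : ∀ t : k, (A + t • B).rank = 2)
    (u : Fin 3 → k) (hu : u ≠ 0) (hAu : A *ᵥ u = 0) (hBu : B *ᵥ u = 0) : False := by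
  obtain ⟨i, hi⟩ : ∃ i, u i ≠ 0 := by
    by_contra! hc
    exact hu (funext hc)
  obtain ⟨a, b, hab⟩ := aux_adj_quad A B i
  obtain ⟨c, hc, hadj⟩ := aux_adj B hB hBr u hu hBu
  have hne : B.adjugate i i ≠ 0 := by rw [hadj]; simp [hc, hi]
  obtain ⟨s, hsq⟩ := IsAlgClosed.exists_pow_nat_eq (discrim (B.adjugate i i) b a) (n := 2) (by norm_num)
  obtain ⟨t, ht⟩ := exists_quadratic_eq_zero hne ⟨s, by rw [← hsq, sq]⟩
  rw [← hab t] at ht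
  obtain ⟨d, hd, hadj'⟩ := aux_adj (A + t • B) (hs t) (hr t) u hu (by
    rw [Matrix.add_mulVec, Matrix.smul_mulVec, hAu, hBu]; simp)
  rw [hadj'] at ht
  simp [hd, hi] at ht

theorem aux_sup {k V : Type*} [Field k] [AddCommGroup V] [Module k V] [FiniteDimensional k V]
    (S T : Submodule k V) (hS : Module.finrank k S = 1) (hT : Module.finrank k T = 1)
    (h : S ≠ T) : Module.finrank k (S ⊔ T : Submodule k V) = 2 := by
  have h1 := Submodule.finrank_sup_add_finrank_inf_eq S T
  have h2 : Module.finrank k (S ⊓ T : Submodule k V) ≤ 1 :=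
    hS ▸ Submodule.finrank_mono inf_le_left
  have h3 : Module.finrank k (S ⊓ T : Submodule k V) ≠ 1 := fun h3 => h (by
    rw [← Submodule.eq_of_le_of_finrank_eq (inf_le_left : S ⊓ T ≤ S) (by omega)]
    exact Submodule.eq_of_le_of_finrank_eq (inf_le_right : S ⊓ T ≤ T) (by omega))
  omega


/-- The Gauss map sends a non-secant line on the secant cubic of the Veronese
surface to a projective line: if `L` is a 2-dimensional space of symmetric
3×3 matrices all of whose nonzero elements have rank exactly 2, then there is
a 2-dimensional subspace `U ⊆ k³` containing the kernels of all nonzero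
elements of `L`; moreover linearly independent elements of `L` have distinct
kernels, and `U` is the sum of any two such kernels. -/
theorem gauss_map_image_of_nonsecant_line_is_line
    (k : Type*) [Field k] [IsAlgClosed k] [CharZero k]
    (L : Submodule k (Matrix (Fin 3) (Fin 3) k))
    (hdim : Module.finrank k L = 2)
    (hsymm : ∀ A ∈ L, A.IsSymm)
    (hrank : ∀ A ∈ L, A ≠ 0 → A.rank = 2) :
    ∃ U : Submodule k (Fin 3 → k), Module.finrank k U = 2 ∧
      (∀ A ∈ L, A ≠ 0 → LinearMap.ker A.mulVecLin ≤ U) ∧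
      (∀ A B : Matrix (Fin 3) (Fin 3) k, A ∈ L → B ∈ L →
        LinearIndependent k ![A, B] →
          LinearMap.ker A.mulVecLin ≠ LinearMap.ker B.mulVecLin ∧
          U = LinearMap.ker A.mulVecLin ⊔ LinearMap.ker B.mulVecLin) := by
  have hdet : ∀ A ∈ L, A.det = 0 := fun A hA => by
    by_cases h0 : A = 0
    · rw [h0]; simp
    · exact aux_det A (hrank A hA h0)
  have hk1 : ∀ A ∈ L, A ≠ 0 → Module.finrank k (LinearMap.ker A.mulVecLin) = 1 :=
    fun A hA h0 => aux_ker A (hrank A hA h0)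
  have hiso : ∀ A ∈ L, A ≠ 0 → ∀ B ∈ L, ∀ p q, A *ᵥ p = 0 → A *ᵥ q = 0 → p ⬝ᵥ B *ᵥ q = 0 :=
    fun A hA h0 B hB p q hp hq => aux_iso A B (hsymm A hA) (hrank A hA h0)
      (fun t => hdet _ (L.add_mem hA (L.smul_mem t hB))) p q hp hq
  have hdist : ∀ A B : Matrix (Fin 3) (Fin 3) k, A ∈ L → B ∈ L → LinearIndependent k ![A, B] →
      LinearMap.ker A.mulVecLin ≠ LinearMap.ker B.mulVecLin := by
    intro A B hA hB hli heq
    have hA0 : A ≠ 0 := hli.ne_zero 0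
    have hB0 : B ≠ 0 := hli.ne_zero 1
    have h1 := hk1 A hA hA0
    obtain ⟨⟨u, hu⟩, hu0⟩ := (Module.finrank_pos_iff_exists_ne_zero
      (R := k) (M := LinearMap.ker A.mulVecLin)).1 (by omega)
    refine aux_distinct A B (hsymm B hB) (hrank B hB hB0)
      (fun t => hsymm _ (L.add_mem hA (L.smul_mem t hB)))
      (fun t => hrank _ (L.add_mem hA (L.smul_mem t hB)) fun h0 => ?_) u
      (by simpa [Subtype.ext_iff] using hu0) (by simpa using hu) (by
        rw [heq] at hu
        simpa using hu)
    have := LinearIndependent.pair_iff.1 hli 1 t (by simpa using h0)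
    exact one_ne_zero this.1
  have hsup : ∀ A B : Matrix (Fin 3) (Fin 3) k, A ∈ L → B ∈ L → LinearIndependent k ![A, B] →
      Module.finrank k
        (LinearMap.ker A.mulVecLin ⊔ LinearMap.ker B.mulVecLin : Submodule k (Fin 3 → k)) = 2 :=
    fun A B hA hB hli => aux_sup _ _ (hk1 A hA (hli.ne_zero 0)) (hk1 B hB (hli.ne_zero 1))
      (hdist A B hA hB hli)
  obtain ⟨A, B, hA, hB, hli, hspan⟩ : ∃ A B : Matrix (Fin 3) (Fin 3) k, A ∈ L ∧ B ∈ L ∧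
      LinearIndependent k ![A, B] ∧ ∀ C ∈ L, ∃ s t : k, C = s • A + t • B := by
    let b := Module.finBasisOfFinrankEq k L hdim
    refine ⟨b 0, b 1, (b 0).2, (b 1).2, ?_, fun C hC => ?_⟩
    · have := b.linearIndependent.map' L.subtype (Submodule.ker_subtype L)
      have e : ![(b 0 : Matrix (Fin 3) (Fin 3) k), b 1] = L.subtype ∘ b := by
        funext i
        fin_cases i <;> rfl
      rw [e]
      exact this
    · refine ⟨b.repr ⟨C, hC⟩ 0, b.repr ⟨C, hC⟩ 1, ?_⟩
      have := b.sum_repr ⟨C, hC⟩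
      rw [Fin.sum_univ_two] at this
      exact (congrArg Subtype.val this).symm
  have hA0 : A ≠ 0 := hli.ne_zero 0
  have hB0 : B ≠ 0 := hli.ne_zero 1
  have hsw : ∀ C ∈ L, ∀ p q, p ⬝ᵥ C *ᵥ q = q ⬝ᵥ C *ᵥ p := fun C hC p q => by
    rw [Matrix.dotProduct_mulVec, ← Matrix.mulVec_transpose, (hsymm C hC).eq, dotProduct_comm]
  set U := LinearMap.ker A.mulVecLin ⊔ LinearMap.ker B.mulVecLin with hU
  have hU2 : Module.finrank k U = 2 := hsup A B hA hB hli
  have hUiso : ∀ C ∈ L, ∀ p ∈ U, ∀ q ∈ U, p ⬝ᵥ C *ᵥ q = 0 := by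
    intro C hC p hp q hq
    obtain ⟨p1, hp1, p2, hp2, rfl⟩ := Submodule.mem_sup.1 hp
    obtain ⟨q1, hq1, q2, hq2, rfl⟩ := Submodule.mem_sup.1 hq
    rw [LinearMap.mem_ker, Matrix.mulVecLin_apply] at hp1 hp2 hq1 hq2
    obtain ⟨s, t, rfl⟩ := hspan C hC
    have a1 := hiso A hA hA0 B hB p1 q1 hp1 hq1
    have a2 := hiso B hB hB0 A hA p2 q2 hp2 hq2
    have a3 := hsw A hA p1 q2
    have a4 := hsw B hB p2 q1
    rw [hp1, dotProduct_zero] at a3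
    rw [hp2, dotProduct_zero] at a4
    simp only [Matrix.add_mulVec, Matrix.smul_mulVec, Matrix.mulVec_add, hq1, hq2,
      dotProduct_add, add_dotProduct, dotProduct_smul, a1, a2, a3, a4, smul_zero, add_zero,
      dotProduct_zero, zero_add]
  have hker : ∀ C ∈ L, C ≠ 0 → LinearMap.ker C.mulVecLin ≤ U := by
    intro C hC hC0 x hx
    by_contra hxU
    rw [LinearMap.mem_ker, Matrix.mulVecLin_apply] at hx
    have htop : U ⊔ Submodule.span k {x} = ⊤ := by
      apply Submodule.eq_top_of_finrank_eq
      have hlt : U < U ⊔ Submodule.span k {x} := by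
        refine lt_of_le_of_ne le_sup_left fun h => hxU ?_
        rw [h]
        exact Submodule.mem_sup_right (Submodule.mem_span_singleton_self x)
      have h1 := Submodule.finrank_lt_finrank_of_lt hlt
      have h2 := Submodule.finrank_le (U ⊔ Submodule.span k {x})
      simp only [Module.finrank_fin_fun] at h2 ⊢
      omega
    have hdec : ∀ y, ∃ q ∈ U, ∃ r : k, y = q + r • x := fun y => by
      have hy : y ∈ U ⊔ Submodule.span k {x} := htop ▸ Submodule.mem_top
      obtain ⟨q, hq, z, hz, rfl⟩ := Submodule.mem_sup.1 hy
      obtain ⟨r, rfl⟩ := Submodule.mem_span_singleton.1 hz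
      exact ⟨q, hq, r, rfl⟩
    have hCU : ∀ p ∈ U, C *ᵥ p = 0 := fun p hp => by
      apply dotProduct_eq_zero
      intro y
      obtain ⟨q, hq, r, rfl⟩ := hdec y
      rw [dotProduct_comm, add_dotProduct, smul_dotProduct, hUiso C hC q hq p hp, hsw C hC x p, hx]
      simp
    apply hC0
    apply Matrix.ext_of_mulVec_single
    intro i
    obtain ⟨q, hq, r, h⟩ := hdec (Pi.single i 1)
    rw [h, Matrix.mulVec_add, Matrix.mulVec_smul, hCU q hq, hx]
    simp
  refine ⟨U, hU2, hker, fun A' B' hA' hB' hli' => ⟨hdist A' B' hA' hB' hli', ?_⟩⟩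
  symm
  apply Submodule.eq_of_le_of_finrank_eq
  · exact sup_le (hker A' hA' (hli'.ne_zero 0)) (hker B' hB' (hli'.ne_zero 1))
  · rw [hsup A' B' hA' hB' hli', hU2]
end

section
/- Let k be an algebraically closed field of characteristic zero, and let L be a 2-dimensional subspace of the space of skew-symmetric 6×6 matrices over k such that every element of L has rank at most 4. Then there exist linearly independent vectors x, y ∈ k⁶ with L ⊆ T_{x,y} = {x uᵀ − u xᵀ + y vᵀ − v yᵀ : u, v ∈ k⁶}. (Every line on the secant cubic of the 8-dimensional Severi variety G(1,5) ⊂ P^14 lies in an embedded tangent space of G(1,5).) -/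
namespace PfLine

variable {k : Type*} [Field k]

/-- Extend an independent family by a vector of a larger subspace. -/
lemma ext_li {n : ℕ} {v : Fin n → Fin 6 → k} (hv : LinearIndependent k v)
    (Q : Submodule k (Fin 6 → k)) (hQ : n < Module.finrank k Q) :
    ∃ q ∈ Q, LinearIndependent k (Matrix.vecCons q v) := by
  by_contra hcon
  push Not at hcon
  have hle : Q ≤ Submodule.span k (Set.range v) := by
    intro q hq
    by_contra hn
    exact hcon q hq (linearIndependent_finCons.2 ⟨hv, hn⟩)
  have h1 := Submodule.finrank_mono hle
  rw [finrank_span_eq_card hv, Fintype.card_fin] at h1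
  omega

/-- The bilinear form attached to a matrix. -/
def bf (A : Matrix (Fin 6) (Fin 6) k) (x y : Fin 6 → k) : k := x ⬝ᵥ A.mulVec y

lemma bf_add (A B : Matrix (Fin 6) (Fin 6) k) (x y) : bf (A + B) x y = bf A x y + bf B x y := by
  simp [bf, Matrix.add_mulVec]

lemma bf_smul (c : k) (A : Matrix (Fin 6) (Fin 6) k) (x y) : bf (c • A) x y = c * bf A x y := by
  simp [bf, Matrix.smul_mulVec]

lemma bf_add_left (A : Matrix (Fin 6) (Fin 6) k) (x x' y) :
    bf A (x + x') y = bf A x y + bf A x' y := by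
  simp [bf]

lemma bf_add_right (A : Matrix (Fin 6) (Fin 6) k) (x y y') :
    bf A x (y + y') = bf A x y + bf A x y' := by
  simp [bf, Matrix.mulVec_add]

lemma bf_smul_left (A : Matrix (Fin 6) (Fin 6) k) (c : k) (x y) :
    bf A (c • x) y = c * bf A x y := by
  simp [bf]

lemma bf_smul_right (A : Matrix (Fin 6) (Fin 6) k) (c : k) (x y) :
    bf A x (c • y) = c * bf A x y := by
  simp [bf, Matrix.mulVec_smul]

lemma bf_skew {A : Matrix (Fin 6) (Fin 6) k} (hA : A.transpose = -A) (x y) :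
    bf A x y = - bf A y x := by
  unfold bf
  rw [Matrix.dotProduct_mulVec, ← Matrix.mulVec_transpose, hA, Matrix.neg_mulVec,
    neg_dotProduct, dotProduct_comm]

lemma bf_self [CharZero k] {A : Matrix (Fin 6) (Fin 6) k} (hA : A.transpose = -A) (x) :
    bf A x x = 0 := by
  have := bf_skew hA x x
  exact self_eq_neg.1 this

lemma bf_ker {A : Matrix (Fin 6) (Fin 6) k} {y} (h : A.mulVec y = 0) (x) : bf A x y = 0 := by
  simp [bf, h]

lemma bf_ker' {A : Matrix (Fin 6) (Fin 6) k} (hA : A.transpose = -A) {y}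
    (h : A.mulVec y = 0) (x) : bf A y x = 0 := by
  rw [bf_skew hA, bf_ker h, neg_zero]

/-- The functional `bf A x`. -/
def bl (A : Matrix (Fin 6) (Fin 6) k) (x : Fin 6 → k) : (Fin 6 → k) →ₗ[k] k where
  toFun := bf A x
  map_add' := bf_add_right A x
  map_smul' := fun c y => by simp [bf_smul_right]

lemma ker_bl (A : Matrix (Fin 6) (Fin 6) k) (x : Fin 6 → k) :
    5 ≤ Module.finrank k (LinearMap.ker (bl A x)) := by
  have h := LinearMap.finrank_range_add_finrank_ker (bl A x)
  have h2 := Submodule.finrank_le (LinearMap.range (bl A x))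
  simp at h h2
  omega

lemma ker_rank {M : Matrix (Fin 6) (Fin 6) k} (h : M.rank ≤ 4) :
    2 ≤ Module.finrank k (LinearMap.ker M.mulVecLin) := by
  have h1 := LinearMap.finrank_range_add_finrank_ker M.mulVecLin
  unfold Matrix.rank at h
  simp at h1
  omega

lemma exists_pair {M : Matrix (Fin 6) (Fin 6) k} (h : M.rank ≤ 4) :
    ∃ v w : Fin 6 → k, M.mulVec v = 0 ∧ M.mulVec w = 0 ∧ LinearIndependent k ![v, w] := by
  have h2 := ker_rank h
  obtain ⟨w, hw, lw⟩ := ext_li (v := (![] : Fin 0 → Fin 6 → k)) linearIndependent_empty_type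
    (LinearMap.ker M.mulVecLin) (by omega)
  obtain ⟨v, hv, lv⟩ := ext_li lw (LinearMap.ker M.mulVecLin) (by omega)
  exact ⟨v, w, by simpa using hv, by simpa using hw, lv⟩

/-- Case of a common kernel vector. -/
lemma common_ker [CharZero k] {A B : Matrix (Fin 6) (Fin 6) k} (hA : A.transpose = -A)
    (hB : B.transpose = -B) (hr : A.rank ≤ 4) {z : Fin 6 → k} (hz : z ≠ 0)
    (hAz : A.mulVec z = 0) (hBz : B.mulVec z = 0) :
    ∃ g : Fin 4 → Fin 6 → k, LinearIndependent k g ∧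
      ∀ i j, bf A (g i) (g j) = 0 ∧ bf B (g i) (g j) = 0 := by
  have l1 : LinearIndependent k ![z] := by
    refine linearIndependent_finCons.2 ⟨linearIndependent_empty_type, ?_⟩
    simpa using hz
  obtain ⟨w, hw, l2⟩ := ext_li l1 _ (lt_of_lt_of_le (by norm_num) (ker_rank hr))
  have hw : A.mulVec w = 0 := by simpa using hw
  have h5 := ker_bl B w
  obtain ⟨p, hp, l3⟩ := ext_li l2 _ (lt_of_lt_of_le (by norm_num) h5)
  obtain ⟨q, hq, l4⟩ := ext_li l3 _ (lt_of_lt_of_le (by norm_num) h5)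
  obtain ⟨r, hrr, l5⟩ := ext_li l4 _ (lt_of_lt_of_le (by norm_num) h5)
  have hp : bf B w p = 0 := hp
  have hq : bf B w q = 0 := hq
  have hrr : bf B w r = 0 := hrr
  obtain ⟨c1, c2, c3, hc, e1, e2, e3⟩ : ∃ c1 c2 c3 : k, ¬ (c1 = 0 ∧ c2 = 0 ∧ c3 = 0) ∧
      bf A (c1 • p + c2 • q + c3 • r) p = 0 ∧ bf A (c1 • p + c2 • q + c3 • r) q = 0 ∧
      bf A (c1 • p + c2 • q + c3 • r) r = 0 := by
    simp only [bf_add_left, bf_smul_left]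
    have s1 := bf_skew hA q p
    have s2 := bf_skew hA r p
    have s3 := bf_skew hA r q
    have t1 := bf_self hA p
    have t2 := bf_self hA q
    have t3 := bf_self hA r
    rw [s1, s2, s3, t1, t2, t3]
    by_cases h : bf A q r = 0 ∧ bf A p r = 0 ∧ bf A p q = 0
    · refine ⟨1, 0, 0, by simp, ?_⟩
      simp [h]
    · refine ⟨bf A q r, - bf A p r, bf A p q, by simpa using h, ?_, ?_, ?_⟩ <;> ring
  set a := c1 • p + c2 • q + c3 • r with ha
  have la : LinearIndependent k ![a, w, z] := by
    rw [Fintype.linearIndependent_iff] at l5 ⊢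
    intro g hg
    have key := l5 ![g 0 * c3, g 0 * c2, g 0 * c1, g 1, g 2] (by
      rw [← hg]
      simp [Fin.sum_univ_succ, ha, smul_add, mul_smul]
      abel)
    have k0 := key 0
    have k1 := key 1
    have k2 := key 2
    have k3 := key 3
    have k4 := key 4
    simp at k0 k1 k2 k3 k4
    have : g 0 = 0 := by tauto
    intro i
    fin_cases i <;> assumption
  let S := Submodule.span k (Set.range ![r, q, p, w, z])
  have hS : Module.finrank k S = 5 := by
    have := finrank_span_eq_card l5
    simpa using this
  have hQ : 3 < Module.finrank k (S ⊓ LinearMap.ker (bl B a) : Submodule k (Fin 6 → k)) := by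
    have := Submodule.finrank_sup_add_finrank_inf_eq S (LinearMap.ker (bl B a))
    have h6 := Submodule.finrank_le (S ⊔ LinearMap.ker (bl B a))
    have := ker_bl B a
    simp at h6
    omega
  obtain ⟨b, hb, l⟩ := ext_li la _ hQ
  obtain ⟨hbS, hbB⟩ := hb
  have hbB : bf B a b = 0 := hbB
  have sub1 : S ≤ LinearMap.ker (bl A a) := by
    refine Submodule.span_le.2 ?_
    rintro _ ⟨i, rfl⟩
    fin_cases i
    · exact e3
    · exact e2
    · exact e1
    · exact bf_ker hw a
    · exact bf_ker hAz a
  have sub2 : S ≤ LinearMap.ker (bl B w) := by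
    refine Submodule.span_le.2 ?_
    rintro _ ⟨i, rfl⟩
    fin_cases i
    · exact hrr
    · exact hq
    · exact hp
    · exact bf_self hB w
    · exact bf_ker hBz w
  have hab : bf A a b = 0 := sub1 hbS
  have hwb : bf B w b = 0 := sub2 hbS
  have hwa : bf B w a = 0 := by
    simp [ha, bf_add_right, bf_smul_right, hp, hq, hrr]
  have hba : bf A b a = 0 := by rw [bf_skew hA, hab, neg_zero]
  have hbw : bf B b w = 0 := by rw [bf_skew hB, hwb, neg_zero]
  have haw : bf B a w = 0 := by rw [bf_skew hB, hwa, neg_zero]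
  have hba' : bf B b a = 0 := by rw [bf_skew hB, hbB, neg_zero]
  clear_value a
  clear ha
  refine ⟨_, l, ?_⟩
  intro i j
  fin_cases i <;> fin_cases j <;>
    simp [bf_self hA, bf_self hB, bf_ker hw, bf_ker hAz, bf_ker hBz, bf_ker' hA hw,
      bf_ker' hA hAz, bf_ker' hB hBz, *]

lemma orth {A B : Matrix (Fin 6) (Fin 6) k} (hA : A.transpose = -A)
    (hB : B.transpose = -B) {s t : k} (hst : s ≠ t) {x y : Fin 6 → k}
    (hx : (A + s • B).mulVec x = 0) (hy : (A + t • B).mulVec y = 0) :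
    bf A x y = 0 ∧ bf B x y = 0 := by
  have h1 := bf_ker hy x
  have h2 := bf_ker' (by rw [Matrix.transpose_add, Matrix.transpose_smul, hA, hB]; simp; abel) hx y
  rw [bf_add, bf_smul] at h1 h2
  have h3 : (s - t) * bf B x y = 0 := by linear_combination h2 - h1
  have h4 : bf B x y = 0 := (mul_eq_zero.1 h3).resolve_left (sub_ne_zero.2 hst)
  rw [h4] at h1
  exact ⟨by simpa using h1, h4⟩

lemma isotropic [CharZero k] {A B : Matrix (Fin 6) (Fin 6) k} (hA : A.transpose = -A)
    (hB : B.transpose = -B) (hr : ∀ s : k, (A + s • B).rank ≤ 4) :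
    ∃ g : Fin 4 → Fin 6 → k, LinearIndependent k g ∧
      ∀ i j, bf A (g i) (g j) = 0 ∧ bf B (g i) (g j) = 0 := by
  by_cases hcom : ∃ z : Fin 6 → k, z ≠ 0 ∧ A.mulVec z = 0 ∧ B.mulVec z = 0
  · obtain ⟨z, hz, h1, h2⟩ := hcom
    exact common_ker hA hB (by simpa using hr 0) hz h1 h2
  push Not at hcom
  choose v w hv hw hl using fun s : k => exists_pair (hr s)
  -- good parameters
  have good : ∃ s t : k, s ≠ t ∧ bf B (v s) (w s) = 0 ∧ bf B (v t) (w t) = 0 := by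
    by_contra hno
    push Not at hno
    have hbad : ∃ e : Fin 7 → k, Function.Injective e ∧ ∀ i, bf B (v (e i)) (w (e i)) ≠ 0 := by
      by_cases hg : ∃ n : ℕ, bf B (v n) (w n) = 0
      · obtain ⟨n, hn⟩ := hg
        refine ⟨fun i => ((n + 1 + i.val : ℕ) : k), ?_, ?_⟩
        · intro i j hij
          have := Nat.cast_injective hij
          ext
          omega
        · intro i
          refine hno n _ ?_ hn
          intro h
          have := Nat.cast_injective h
          omega
      · push Not at hg
        refine ⟨fun i => ((i.val : ℕ) : k), ?_, fun i => hg _⟩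
        intro i j hij
        exact Fin.ext (Nat.cast_injective hij)
    obtain ⟨e, he, hb⟩ := hbad
    have hli : LinearIndependent k (fun i => v (e i)) := by
      rw [Fintype.linearIndependent_iff]
      intro g hg i
      have h0 : bl B (w (e i)) (∑ j, g j • v (e j)) = 0 := by rw [hg, map_zero]
      rw [map_sum, Finset.sum_eq_single i] at h0
      · rw [map_smul, smul_eq_mul] at h0
        refine (mul_eq_zero.1 h0).resolve_right ?_
        intro h
        apply hb i
        rw [bf_skew hB]
        exact neg_eq_zero.2 h
      · intro j _ hj
        rw [map_smul]
        have : bl B (w (e i)) (v (e j)) = 0 :=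
          (orth hA hB (fun h => hj (he h.symm)) (hw _) (hv _)).2
        rw [this, smul_zero]
      · simp
    have := hli.fintype_card_le_finrank
    simp at this
  obtain ⟨s, t, hst, hs, ht⟩ := good
  have hA' : ∀ s, bf B (v s) (w s) = 0 → bf A (v s) (w s) = 0 := by
    intro s hs
    have := bf_ker (hw s) (v s)
    rw [bf_add, bf_smul, hs] at this
    simpa using this
  have hs' := hA' s hs
  have ht' := hA' t ht
  refine ⟨![v s, w s, v t, w t], ?_, ?_⟩
  · have ls := hl s
    have lt := hl t
    rw [LinearIndependent.pair_iff] at ls lt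
    rw [Fintype.linearIndependent_iff]
    intro g hg
    simp only [Fin.sum_univ_four] at hg
    simp at hg
    have hx : (A + s • B).mulVec (g 0 • v s + g 1 • w s) = 0 := by
      rw [Matrix.mulVec_add, Matrix.mulVec_smul, Matrix.mulVec_smul, hv, hw]; simp
    have hy : (A + t • B).mulVec (g 2 • v t + g 3 • w t) = 0 := by
      rw [Matrix.mulVec_add, Matrix.mulVec_smul, Matrix.mulVec_smul, hv, hw]; simp
    have hxy : g 0 • v s + g 1 • w s = -(g 2 • v t + g 3 • w t) := by
      rw [eq_neg_iff_add_eq_zero, ← hg]; abel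
    set x := g 0 • v s + g 1 • w s
    have hy' : (A + t • B).mulVec x = 0 := by rw [hxy, Matrix.mulVec_neg, hy, neg_zero]
    rw [Matrix.add_mulVec, Matrix.smul_mulVec] at hx hy'
    have hBx : B.mulVec x = 0 := by
      have : (s - t) • B.mulVec x = 0 := by
        rw [sub_smul, sub_eq_zero]
        exact add_left_cancel (hx.trans hy'.symm)
      exact (smul_eq_zero.1 this).resolve_left (sub_ne_zero.2 hst)
    have hAx : A.mulVec x = 0 := by simpa [hBx] using hx
    have hx0 : x = 0 := by
      by_contra hne
      exact hcom x hne hAx hBx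
    have hy0 : g 2 • v t + g 3 • w t = 0 := by
      rw [hx0] at hxy
      exact neg_eq_zero.1 hxy.symm
    obtain ⟨a0, a1⟩ := ls _ _ hx0
    obtain ⟨a2, a3⟩ := lt _ _ hy0
    intro i
    fin_cases i <;> assumption
  · have h1 := orth hA hB hst (hv s) (hv t)
    have h2 := orth hA hB hst (hv s) (hw t)
    have h3 := orth hA hB hst (hw s) (hv t)
    have h4 := orth hA hB hst (hw s) (hw t)
    have h5 := orth hA hB hst.symm (hv t) (hv s)
    have h6 := orth hA hB hst.symm (hv t) (hw s)
    have h7 := orth hA hB hst.symm (hw t) (hv s)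
    have h8 := orth hA hB hst.symm (hw t) (hw s)
    have i1 : bf A (w s) (v s) = 0 := by rw [bf_skew hA, hs', neg_zero]
    have i2 : bf B (w s) (v s) = 0 := by rw [bf_skew hB, hs, neg_zero]
    have i3 : bf A (w t) (v t) = 0 := by rw [bf_skew hA, ht', neg_zero]
    have i4 : bf B (w t) (v t) = 0 := by rw [bf_skew hB, ht, neg_zero]
    intro i j
    fin_cases i <;> fin_cases j <;> simp [bf_self hA, bf_self hB, *]

lemma normal_form [CharZero k] {M : Matrix (Fin 6) (Fin 6) k} (hM : M.transpose = -M)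
    (h0 : ∀ i j : Fin 6, 2 ≤ i → 2 ≤ j → M i j = 0) :
    ∃ u v : Fin 6 → k, M = Matrix.vecMulVec (Pi.single 0 1) u - Matrix.vecMulVec u (Pi.single 0 1)
      + Matrix.vecMulVec (Pi.single 1 1) v - Matrix.vecMulVec v (Pi.single 1 1) := by
  have hs : ∀ i j, M i j = - M j i := fun i j => by
    have := congrFun (congrFun hM j) i
    simpa using this
  have hd : ∀ i, M i i = 0 := fun i => self_eq_neg.1 (hs i i)
  refine ⟨M 0, fun j => if 2 ≤ j then M 1 j else 0, ?_⟩
  ext i j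
  fin_cases i <;> fin_cases j <;>
    first
    | (simp [Matrix.vecMulVec_apply, hd]; done)
    | (simp [Matrix.vecMulVec_apply, hd]; exact hs _ _)
    | (simp [Matrix.vecMulVec_apply]; exact h0 _ _ (by decide) (by decide))

lemma decomp [CharZero k] {g : Fin 4 → Fin 6 → k} (hg : LinearIndependent k g) :
    ∃ x y : Fin 6 → k, LinearIndependent k ![x, y] ∧
      ∀ A : Matrix (Fin 6) (Fin 6) k, A.transpose = -A → (∀ i j, bf A (g i) (g j) = 0) →
      ∃ u v : Fin 6 → k, A = Matrix.vecMulVec x u - Matrix.vecMulVec u x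
            + Matrix.vecMulVec y v - Matrix.vecMulVec v y := by
  obtain ⟨q, -, l5⟩ := ext_li hg ⊤ (by simp)
  obtain ⟨p, -, l6⟩ := ext_li l5 ⊤ (by simp)
  let G : Matrix (Fin 6) (Fin 6) k := Matrix.of (Matrix.vecCons p (Matrix.vecCons q g))
  have hG : IsUnit G := Matrix.linearIndependent_rows_iff_isUnit.1 l6
  have hdet := (Matrix.isUnit_iff_isUnit_det G).1 hG
  have hHG : G⁻¹ * G = 1 := Matrix.nonsing_inv_mul G hdet
  have hGH : G * G⁻¹ = 1 := Matrix.mul_nonsing_inv G hdet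
  generalize G⁻¹ = H at hHG hGH
  have hGG : ∀ x : Fin 6 → k, G.mulVec (H.mulVec x) = x := fun x => by
    rw [Matrix.mulVec_mulVec, hGH, Matrix.one_mulVec]
  refine ⟨H.mulVec (Pi.single 0 1), H.mulVec (Pi.single 1 1), ?_, ?_⟩
  · rw [LinearIndependent.pair_iff]
    intro a b hab
    have := congrArg G.mulVec hab
    rw [Matrix.mulVec_add, Matrix.mulVec_smul, Matrix.mulVec_smul, hGG, hGG,
      Matrix.mulVec_zero] at this
    have h0 := congrFun this 0
    have h1 := congrFun this 1
    simp at h0 h1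
    exact ⟨h0, h1⟩
  · intro A hA hiso
    have hM : (G * A * G.transpose).transpose = -(G * A * G.transpose) := by
      rw [Matrix.transpose_mul, Matrix.transpose_mul, hA, Matrix.transpose_transpose]
      simp [Matrix.mul_assoc]
    have hent : ∀ i j, (G * A * G.transpose) i j = bf A (G i) (G j) := by
      intro i j
      rw [Matrix.mul_assoc]
      rfl
    obtain ⟨u, v, huv⟩ := normal_form hM (by
      intro i j hi hj
      rw [hent]
      obtain ⟨i', rfl⟩ : ∃ i' : Fin 4, i = i'.succ.succ := by
        revert i; decide
      obtain ⟨j', rfl⟩ : ∃ j' : Fin 4, j = j'.succ.succ := by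
        revert j; decide
      exact hiso i' j')
    refine ⟨H.mulVec u, H.mulVec v, ?_⟩
    have hA2 : A = H * (G * A * G.transpose) * H.transpose := by
      have : G.transpose * H.transpose = 1 := by
        rw [← Matrix.transpose_mul, hHG, Matrix.transpose_one]
      calc A = (H * G) * A * (G.transpose * H.transpose) := by rw [hHG, this]; simp
        _ = _ := by simp only [Matrix.mul_assoc]
    have hvv : ∀ a b : Fin 6 → k, H * Matrix.vecMulVec a b * H.transpose
        = Matrix.vecMulVec (H.mulVec a) (H.mulVec b) := by
      intro a b
      rw [Matrix.mul_vecMulVec, Matrix.vecMulVec_mul, Matrix.vecMul_transpose]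
    rw [hA2, huv]
    simp only [Matrix.mul_add, Matrix.mul_sub, Matrix.add_mul, Matrix.sub_mul, hvv]

end PfLine

/-- Every line on the secant (Pfaffian) cubic of the Grassmannian
`G(1,5) ⊂ P¹⁴` lies in an embedded tangent space: if `L` is a 2-dimensional
space of skew-symmetric 6×6 matrices of rank at most 4, then there are
linearly independent `x, y ∈ k⁶` with `L ⊆ T_{x,y}`. -/
theorem lines_on_pfaffian_cubic_in_tangent_space
    (k : Type*) [Field k] [IsAlgClosed k] [CharZero k]
    (L : Submodule k (Matrix (Fin 6) (Fin 6) k))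
    (hdim : Module.finrank k L = 2)
    (hskew : ∀ A ∈ L, A.transpose = -A)
    (hrank : ∀ A ∈ L, A.rank ≤ 4) :
    ∃ x y : Fin 6 → k, LinearIndependent k ![x, y] ∧
      ∀ A ∈ L, ∃ u v : Fin 6 → k,
        A = Matrix.vecMulVec x u - Matrix.vecMulVec u x
            + Matrix.vecMulVec y v - Matrix.vecMulVec v y := by
  let bs := Module.finBasisOfFinrankEq k L hdim
  obtain ⟨g, hg, hiso⟩ := PfLine.isotropic (hskew _ (bs 0).2) (hskew _ (bs 1).2)
    (fun s => hrank _ (L.add_mem (bs 0).2 (L.smul_mem s (bs 1).2)))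
  obtain ⟨x, y, hxy, h⟩ := PfLine.decomp hg
  refine ⟨x, y, hxy, fun A hA => h A (hskew A hA) fun i j => ?_⟩
  have hrep := congrArg Subtype.val (bs.sum_repr ⟨A, hA⟩)
  rw [Fin.sum_univ_two] at hrep
  simp only [Submodule.coe_add, Submodule.coe_smul] at hrep
  rw [← hrep, PfLine.bf_add, PfLine.bf_smul, PfLine.bf_smul, (hiso i j).1, (hiso i j).2]
  simp
end

section
/- Let k be a field of characteristic zero. There exists a 2-dimensional subspace L of the space of 3×3 matrices over k, all of whose elements are singular, together with nonzero vectors a, b ∈ k³, such that the rank-1 elements of L are exactly the nonzero scalar multiples of a bᵀ, and L is not contained in T_{a,b} = {a uᵀ + v bᵀ : u, v ∈ k³}. (Unlike the case of the Veronese surface, the secant cubic of the Segre fourfold contains lines meeting the Segre fourfold transversally at a single point: lines of type III exist.) -/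
/-- The pencil of matrices used as the type III line. -/
def typeIIIMap (k : Type*) [Field k] : (k × k) →ₗ[k] Matrix (Fin 3) (Fin 3) k where
  toFun p := !![p.1, 0, 0; 0, p.2, 0; p.2, 0, 0]
  map_add' p q := by
    ext i j; fin_cases i <;> fin_cases j <;> simp
  map_smul' c p := by
    ext i j; fin_cases i <;> fin_cases j <;> simp

theorem typeIIIMap_apply (k : Type*) [Field k] (s t : k) :
    typeIIIMap k (s, t) = !![s, 0, 0; 0, t, 0; t, 0, 0] := rfl

/-- The secant cubic of the Segre fourfold contains lines of type III: there
is a 2-dimensional space `L` of singular 3×3 matrices and nonzero `a, b ∈ k³`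
such that the rank-1 elements of `L` are exactly the nonzero scalar multiples
of `a bᵀ`, yet `L` is not contained in the embedded tangent space
`T_{a,b}`. -/
theorem type_III_lines_exist_on_secant_segre
    (k : Type*) [Field k] [CharZero k] :
    ∃ (L : Submodule k (Matrix (Fin 3) (Fin 3) k)) (a b : Fin 3 → k),
      a ≠ 0 ∧ b ≠ 0 ∧
      Module.finrank k L = 2 ∧
      (∀ A ∈ L, A.det = 0) ∧
      (∀ A : Matrix (Fin 3) (Fin 3) k,
        (A ∈ L ∧ A.rank = 1) ↔ ∃ c : k, c ≠ 0 ∧ A = c • Matrix.vecMulVec a b) ∧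
      ¬ (∀ A ∈ L, ∃ u v : Fin 3 → k,
          A = Matrix.vecMulVec a u + Matrix.vecMulVec v b) := by
  have key : ∀ c : k, c • Matrix.vecMulVec ![(1 : k), 0, 0] ![(1 : k), 0, 0]
      = typeIIIMap k (c, 0) := by
    intro c
    rw [typeIIIMap_apply]
    ext i j; fin_cases i <;> fin_cases j <;> simp [Matrix.vecMulVec_apply]
  refine ⟨LinearMap.range (typeIIIMap k), ![1, 0, 0], ![1, 0, 0], ?_, ?_, ?_, ?_, ?_, ?_⟩
  · intro h
    simpa using congrFun h 0
  · intro h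
    simpa using congrFun h 0
  · rw [LinearMap.finrank_range_of_inj]
    · simp
    · rintro ⟨s, t⟩ ⟨s', t'⟩ h
      rw [typeIIIMap_apply, typeIIIMap_apply] at h
      have h1 := congrFun (congrFun h 0) 0
      have h2 := congrFun (congrFun h 1) 1
      simp at h1 h2
      rw [h1, h2]
  · rintro A ⟨⟨s, t⟩, rfl⟩
    rw [typeIIIMap_apply]
    simp [Matrix.det_fin_three]
  · intro A
    constructor
    · rintro ⟨⟨⟨s, t⟩, rfl⟩, hr⟩
      by_cases ht : t = 0
      · subst ht
        refine ⟨s, ?_, (key s).symm⟩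
        rintro rfl
        have h0 : typeIIIMap k (0, 0) = 0 := (typeIIIMap k).map_zero
        rw [h0, Matrix.rank_zero] at hr
        exact absurd hr (by norm_num)
      · exfalso
        have hle := Matrix.rank_submatrix_le (typeIIIMap k (s, t)) ![(1 : Fin 3), 2]
          ![(1 : Fin 3), 0]
        rw [Matrix.rank_of_det_ne_zero, hr] at hle
        · simp at hle
        · rw [typeIIIMap_apply]
          rw [Matrix.det_fin_two]
          simp only [Matrix.submatrix_apply]
          simp [ht]
    · rintro ⟨c, hc, rfl⟩
      refine ⟨⟨(c, 0), (key c).symm⟩, le_antisymm ?_ ?_⟩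
      · rw [← Matrix.smul_vecMulVec]
        exact Matrix.rank_vecMulVec_le _ _
      · rw [key]
        have hle := Matrix.rank_submatrix_le (typeIIIMap k (c, 0)) ![(0 : Fin 3)]
          ![(0 : Fin 3)]
        rw [Matrix.rank_of_det_ne_zero] at hle
        · simpa using hle
        · rw [typeIIIMap_apply]
          rw [Matrix.det_fin_one, Matrix.submatrix_apply]
          simpa using hc
  · intro h
    obtain ⟨u, v, huv⟩ := h (typeIIIMap k (0, 1)) ⟨_, rfl⟩
    rw [typeIIIMap_apply] at huv
    have h1 := congrFun (congrFun huv 1) 1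
    rw [Matrix.add_apply, Matrix.vecMulVec_apply, Matrix.vecMulVec_apply] at h1
    simp at h1
end

section
/- Let k be a field of characteristic zero, and let x, y ∈ k⁶ and x', y' ∈ k⁶ be two pairs of linearly independent vectors. If the subspaces T_{x,y} = {x uᵀ − u xᵀ + y vᵀ − v yᵀ : u, v ∈ k⁶} and T_{x',y'} = {x' uᵀ − u x'ᵀ + y' vᵀ − v y'ᵀ : u, v ∈ k⁶} of skew-symmetric 6×6 matrices are equal, then the span of {x, y} equals the span of {x', y'}. (Uniqueness of tangency for the Grassmannian G(1,5): distinct points of G(1,5) have distinct embedded tangent spaces.) -/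
/-- If `x ∧ u` lies in `T_{p,q}` for all `u`, then `x` lies in the span of `p, q`. -/
theorem mem_span_of_wedge {k : Type*} [Field k] (x p q : Fin 6 → k)
    (h : ∀ u : Fin 6 → k, ∃ a b : Fin 6 → k,
      Matrix.vecMulVec x u - Matrix.vecMulVec u x
        = Matrix.vecMulVec p a - Matrix.vecMulVec a p
          + Matrix.vecMulVec q b - Matrix.vecMulVec b q) :
    x ∈ Submodule.span k {p, q} := by
  classical
  by_contra hx
  obtain ⟨ψ, hψx, hψ⟩ := Submodule.exists_le_ker_of_notMem hx
  have hne : Submodule.span k ({x, p, q} : Set (Fin 6 → k)) ≠ ⊤ := by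
    intro htop
    have h1 := finrank_span_finset_le_card (R := k) ({x, p, q} : Finset (Fin 6 → k))
    have h2 : ({x, p, q} : Finset (Fin 6 → k)).card ≤ 3 := Finset.card_le_three
    have h3 : (({x, p, q} : Finset (Fin 6 → k)) : Set (Fin 6 → k)) = {x, p, q} := by simp
    have h4 : Module.finrank k (Submodule.span k ({x, p, q} : Set (Fin 6 → k))) ≤
        ({x, p, q} : Finset (Fin 6 → k)).card := by
      rw [← h3]; exact h1
    rw [htop, finrank_top, Module.finrank_fin_fun] at h4
    omega
  obtain ⟨u, hu⟩ : ∃ u, u ∉ Submodule.span k ({x, p, q} : Set (Fin 6 → k)) := by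
    by_contra hc
    push Not at hc
    exact hne (eq_top_iff.2 fun z _ => hc z)
  obtain ⟨φ, hφu, hφ⟩ := Submodule.exists_le_ker_of_notMem hu
  have hφx : φ x = 0 := hφ (Submodule.subset_span (by simp))
  have hφp : φ p = 0 := hφ (Submodule.subset_span (by simp))
  have hφq : φ q = 0 := hφ (Submodule.subset_span (by simp))
  have hψp : ψ p = 0 := hψ (Submodule.subset_span (by simp))
  have hψq : ψ q = 0 := hψ (Submodule.subset_span (by simp))
  obtain ⟨a, b, hab⟩ := h u
  have key : φ u • x = φ a • p + φ b • q := by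
    funext i
    have hrow : x i • u - u i • x = p i • a - a i • p + q i • b - b i • q := by
      funext j
      simpa [Matrix.vecMulVec_apply] using congrFun (congrFun hab i) j
    have := congrArg φ hrow
    simp only [map_sub, map_add, map_smul, hφx, hφp, hφq, smul_eq_mul] at this
    simp only [Pi.add_apply, Pi.smul_apply, smul_eq_mul]
    linear_combination this
  have := congrArg ψ key
  simp only [map_add, map_smul, hψp, hψq, smul_eq_mul, mul_zero, add_zero] at this
  exact (mul_ne_zero hφu hψx) this

/-- One inclusion of tangent spaces gives one inclusion of spans. -/
theorem span_le_of_tangent_le {k : Type*} [Field k] (x y p q : Fin 6 → k)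
    (h : ∀ A : Matrix (Fin 6) (Fin 6) k,
      (∃ u v, A = Matrix.vecMulVec x u - Matrix.vecMulVec u x
                       + Matrix.vecMulVec y v - Matrix.vecMulVec v y) →
      ∃ u v, A = Matrix.vecMulVec p u - Matrix.vecMulVec u p
                       + Matrix.vecMulVec q v - Matrix.vecMulVec v q) :
    Submodule.span k {x, y} ≤ Submodule.span k {p, q} := by
  rw [Submodule.span_le]
  rintro z (rfl | rfl)
  · exact mem_span_of_wedge _ _ _ fun u => h _ ⟨u, 0, by simp⟩
  · exact mem_span_of_wedge _ _ _ fun u => h _ ⟨0, u, by simp⟩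

/-- Uniqueness of tangency for the Grassmannian `G(1,5)`: if the affine cones
over the embedded tangent spaces `T_{x,y}` and `T_{x',y'}` coincide for two
pairs of linearly independent vectors in `k⁶`, then `span {x, y} =
span {x', y'}`. -/
theorem grassmannian_unique_tangency
    (k : Type*) [Field k] [CharZero k]
    (x y x' y' : Fin 6 → k)
    (hxy : LinearIndependent k ![x, y])
    (hxy' : LinearIndependent k ![x', y'])
    (h : {A : Matrix (Fin 6) (Fin 6) k |
            ∃ u v, A = Matrix.vecMulVec x u - Matrix.vecMulVec u x
                       + Matrix.vecMulVec y v - Matrix.vecMulVec v y} =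
         {A : Matrix (Fin 6) (Fin 6) k |
            ∃ u v, A = Matrix.vecMulVec x' u - Matrix.vecMulVec u x'
                       + Matrix.vecMulVec y' v - Matrix.vecMulVec v y'}) :
    Submodule.span k {x, y} = Submodule.span k {x', y'} := by
  exact le_antisymm
    (span_le_of_tangent_le x y x' y' fun A hA => (Set.ext_iff.1 h A).1 hA)
    (span_le_of_tangent_le x' y' x y fun A hA => (Set.ext_iff.1 h A).2 hA)
end
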